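/- Let α ∈ ℝ and α̃ = max{1−α, 0}. If for every i = 1,…,N the blocks satisfy S_i = (α/2)I, 0 ≺ R_i ≺ (1/(2d_i))I, and Q_i ≺ −2d_i α̃ I, then the global LMI under Laplacian coupling holds: Q − SL − LSᵀ + LRL ≺ 0. -/

import Mathlib

open Matrix Kronecker

/-- Block-diagonal matrix built from `N` blocks of size `a × b`. -/
def blkDiag {N a b : ℕ} (M : Fin N → Matrix (Fin a) (Fin b) ℝ) :
    Matrix (Fin N × Fin a) (Fin N × Fin b) ℝ :=
  Matrix.of fun x y => if x.1 = y.1 then M x.1 x.2 y.2 else 0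

/-- The quadratic form of the Laplacian as a weighted sum of squared differences. -/
theorem two_mul_sum_laplacian {ι : Type*} [Fintype ι] (A : Matrix ι ι ℝ) (hA : A.IsSymm)
    (v : ι → ℝ) :
    2 * ∑ i, v i * ∑ j, A i j * (v i - v j) = ∑ i, ∑ j, A i j * (v i - v j) ^ 2 := by
  have h1 : ∑ i, v i * ∑ j, A i j * (v i - v j) = ∑ i, ∑ j, A i j * (v j * (v j - v i)) := by
    rw [Finset.sum_comm]
    refine Finset.sum_congr rfl fun i _ => ?_
    rw [Finset.mul_sum]
    refine Finset.sum_congr rfl fun j _ => ?_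
    rw [hA.apply i j]
    ring
  rw [two_mul]
  nth_rewrite 2 [h1]
  rw [← Finset.sum_add_distrib]
  refine Finset.sum_congr rfl fun i _ => ?_
  rw [Finset.mul_sum, ← Finset.sum_add_distrib]
  exact Finset.sum_congr rfl fun j _ => by ring

/-- `ℒ 𝒟⁻¹ ℒ ⪯ 2 ℒ` as an inequality of quadratic forms. -/
theorem sum_sq_laplacian_div_le {ι : Type*} [Fintype ι] (A : Matrix ι ι ℝ) (hA : A.IsSymm)
    (hnn : ∀ i j, 0 ≤ A i j) (d : ι → ℝ) (hd : ∀ i, d i = ∑ j, A i j)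
    (hpos : ∀ i, 0 < d i) (v : ι → ℝ) :
    ∑ i, 1 / (2 * d i) * (∑ j, A i j * (v i - v j)) ^ 2
      ≤ ∑ i, v i * ∑ j, A i j * (v i - v j) := by
  have h := two_mul_sum_laplacian A hA v
  have h2 : ∑ i, 1 / (2 * d i) * (∑ j, A i j * (v i - v j)) ^ 2
      ≤ ∑ i, 1 / 2 * ∑ j, A i j * (v i - v j) ^ 2 := by
    refine Finset.sum_le_sum fun i _ => ?_
    have hcs : (∑ j, A i j * (v i - v j)) ^ 2 ≤ d i * ∑ j, A i j * (v i - v j) ^ 2 := by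
      rw [hd i]
      refine Finset.sum_sq_le_sum_mul_sum_of_sq_le_mul _ (fun j _ => hnn i j)
        (fun j _ => mul_nonneg (hnn i j) (sq_nonneg _)) fun j _ => (by ring : _ = _).le
    have hdi := hpos i
    calc 1 / (2 * d i) * (∑ j, A i j * (v i - v j)) ^ 2
        ≤ 1 / (2 * d i) * (d i * ∑ j, A i j * (v i - v j) ^ 2) := by gcongr
      _ = _ := by field_simp
  rw [← Finset.mul_sum] at h2
  linarith

/-- `ℒ ⪯ 2 𝒟` as an inequality of quadratic forms. -/
theorem sum_laplacian_le {ι : Type*} [Fintype ι] (A : Matrix ι ι ℝ) (hA : A.IsSymm)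
    (hnn : ∀ i j, 0 ≤ A i j) (d : ι → ℝ) (hd : ∀ i, d i = ∑ j, A i j) (v : ι → ℝ) :
    ∑ i, v i * ∑ j, A i j * (v i - v j) ≤ ∑ i, 2 * d i * v i ^ 2 := by
  have h := two_mul_sum_laplacian A hA v
  have h2 : ∑ i, ∑ j, A i j * (v i - v j) ^ 2
      ≤ ∑ i, ∑ j, (2 * (A i j * v i ^ 2) + 2 * (A i j * v j ^ 2)) := by
    refine Finset.sum_le_sum fun i _ => Finset.sum_le_sum fun j _ => ?_
    nlinarith [mul_nonneg (hnn i j) (sq_nonneg (v i + v j))]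
  have h3 : ∑ i, ∑ j, 2 * (A i j * v j ^ 2) = ∑ i, 2 * d i * v i ^ 2 := by
    rw [Finset.sum_comm]
    refine Finset.sum_congr rfl fun i _ => ?_
    rw [hd i, Finset.mul_sum, Finset.sum_mul]
    refine Finset.sum_congr rfl fun j _ => ?_
    rw [hA.apply i j]
    ring
  have h4 : ∑ i, ∑ j, 2 * (A i j * v i ^ 2) = ∑ i, 2 * d i * v i ^ 2 := by
    refine Finset.sum_congr rfl fun i _ => ?_
    rw [hd i, Finset.mul_sum, Finset.sum_mul]
    exact Finset.sum_congr rfl fun j _ => by ring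
  simp only [Finset.sum_add_distrib] at h2
  linarith

theorem blkDiag_isSymm {N m : ℕ} {M : Fin N → Matrix (Fin m) (Fin m) ℝ}
    (hM : ∀ i, (M i).IsSymm) : (blkDiag M).IsSymm := by
  refine Matrix.IsSymm.ext fun x y => ?_
  by_cases h : x.1 = y.1
  · simp [blkDiag, h, (hM y.1).apply]
  · simp [blkDiag, h, Ne.symm h]

theorem dotProduct_blkDiag_mulVec {N m : ℕ} (M : Fin N → Matrix (Fin m) (Fin m) ℝ)
    (x : Fin N × Fin m → ℝ) :
    x ⬝ᵥ (blkDiag M *ᵥ x) = ∑ i, (fun k => x (i, k)) ⬝ᵥ (M i *ᵥ fun k => x (i, k)) := by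
  simp [dotProduct, mulVec, blkDiag, Fintype.sum_prod_type, ite_mul, Finset.sum_ite_irrel]

theorem blkDiag_smul_one {N m : ℕ} (c : ℝ) :
    blkDiag (fun _ : Fin N => c • (1 : Matrix (Fin m) (Fin m) ℝ)) = c • 1 := by
  ext ⟨i, k⟩ ⟨j, l⟩
  by_cases h : i = j <;> simp [blkDiag, h, Matrix.one_apply]

theorem laplacian_kronecker_one_mulVec {N m : ℕ} (A : Matrix (Fin N) (Fin N) ℝ)
    (d : Fin N → ℝ) (hd : ∀ i, d i = ∑ j, A i j) (x : Fin N × Fin m → ℝ) (i : Fin N)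
    (k : Fin m) :
    (((Matrix.diagonal d - A) ⊗ₖ (1 : Matrix (Fin m) (Fin m) ℝ)) *ᵥ x) (i, k)
      = ∑ j, A i j * (x (i, k) - x (j, k)) := by
  simp [mulVec, dotProduct, Fintype.sum_prod_type, Matrix.one_apply, sub_mul, mul_sub,
    Matrix.diagonal_apply, Finset.sum_sub_distrib, hd i, Finset.sum_mul]

theorem dotProduct_smul_one_sub_mulVec {m : ℕ} (c : ℝ) (M : Matrix (Fin m) (Fin m) ℝ)
    (x : Fin m → ℝ) :
    x ⬝ᵥ ((c • (1 : Matrix (Fin m) (Fin m) ℝ) - M) *ᵥ x)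
      = ∑ k, c * x k ^ 2 - x ⬝ᵥ (M *ᵥ x) := by
  rw [Matrix.sub_mulVec, dotProduct_sub, Matrix.smul_mulVec, Matrix.one_mulVec,
    dotProduct_smul, smul_eq_mul, dotProduct, Finset.mul_sum]
  congr 1
  exact Finset.sum_congr rfl fun k _ => by ring

/-- Decentralized condition (a): if `S_i = (α/2)I`, `0 ≺ R_i ≺ (1/(2d_i))I` and
`Q_i ≺ −2d_iα̃I` with `α̃ = max{1−α, 0}`, then `Q − SL − LSᵀ + LRL ≺ 0`
under Laplacian coupling. -/
theorem decentralized_LMI_alpha {N m : ℕ}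
    (𝒜 : Matrix (Fin N) (Fin N) ℝ)
    (h𝒜symm : 𝒜.IsSymm) (h𝒜nonneg : ∀ i j, 0 ≤ 𝒜 i j) (h𝒜diag : ∀ i, 𝒜 i i = 0)
    (d : Fin N → ℝ) (hd : ∀ i, d i = ∑ j, 𝒜 i j) (hdpos : ∀ i, 0 < d i)
    (ℒ : Matrix (Fin N) (Fin N) ℝ) (hℒ : ℒ = Matrix.diagonal d - 𝒜)
    (hconn : ∀ v : Fin N → ℝ, ℒ *ᵥ v = 0 → ∃ c : ℝ, v = fun _ => c)
    (L : Matrix (Fin N × Fin m) (Fin N × Fin m) ℝ)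
    (hL : L = ℒ ⊗ₖ (1 : Matrix (Fin m) (Fin m) ℝ))
    (Q S R : Fin N → Matrix (Fin m) (Fin m) ℝ)
    (hQsymm : ∀ i, (Q i).IsSymm) (hRsymm : ∀ i, (R i).IsSymm)
    (α αt : ℝ) (hαt : αt = max (1 - α) 0)
    (hS : ∀ i, S i = (α / 2) • (1 : Matrix (Fin m) (Fin m) ℝ))
    (hRpos : ∀ i, (R i).PosDef)
    (hRub : ∀ i, ((1 / (2 * d i)) • (1 : Matrix (Fin m) (Fin m) ℝ) - R i).PosDef)
    (hQub : ∀ i, (-((2 * d i * αt) • (1 : Matrix (Fin m) (Fin m) ℝ)) - Q i).PosDef) :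
    (-(blkDiag Q - blkDiag S * L - L * (blkDiag S)ᵀ + L * blkDiag R * L)).PosDef := by
  have hSeq : blkDiag S = (α / 2) • 1 := by
    rw [← blkDiag_smul_one]
    exact congrArg blkDiag (funext hS)
  have hLsymm : L.IsSymm := by
    rw [hL, hℒ, Matrix.IsSymm, ← Matrix.kroneckerMap_transpose, Matrix.transpose_sub,
      h𝒜symm.eq, Matrix.diagonal_transpose, Matrix.transpose_one]
  have hmat : -(blkDiag Q - blkDiag S * L - L * (blkDiag S)ᵀ + L * blkDiag R * L)
      = α • L - blkDiag Q - L * blkDiag R * L := by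
    rw [hSeq, Matrix.transpose_smul, Matrix.transpose_one, Matrix.smul_mul, Matrix.mul_smul,
      Matrix.one_mul, Matrix.mul_one]
    module
  rw [hmat]
  refine Matrix.PosDef.of_dotProduct_mulVec_pos ?_ fun x hx => ?_
  · rw [Matrix.IsHermitian, Matrix.conjTranspose_eq_transpose_of_trivial]
    simp only [Matrix.transpose_sub, Matrix.transpose_smul, Matrix.transpose_mul, hLsymm.eq,
      (blkDiag_isSymm hQsymm).eq, (blkDiag_isSymm hRsymm).eq, Matrix.mul_assoc]
  rw [star_trivial]
  set y := L *ᵥ x with hy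
  have hyx : ∀ i k, y (i, k) = ∑ j, 𝒜 i j * (x (i, k) - x (j, k)) := fun i k => by
    rw [hy, hL, hℒ, laplacian_kronecker_one_mulVec 𝒜 d hd]
  have hquad : x ⬝ᵥ ((α • L - blkDiag Q - L * blkDiag R * L) *ᵥ x)
      = α * (x ⬝ᵥ y) - x ⬝ᵥ (blkDiag Q *ᵥ x) - y ⬝ᵥ (blkDiag R *ᵥ y) := by
    have h : x ⬝ᵥ (L *ᵥ (blkDiag R *ᵥ y)) = y ⬝ᵥ (blkDiag R *ᵥ y) := by
      rw [Matrix.dotProduct_mulVec, ← Matrix.mulVec_transpose, hLsymm.eq]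
    rw [Matrix.sub_mulVec, Matrix.sub_mulVec, dotProduct_sub, dotProduct_sub,
      Matrix.smul_mulVec, dotProduct_smul, smul_eq_mul, ← Matrix.mulVec_mulVec,
      ← Matrix.mulVec_mulVec, h]
  have hxy : x ⬝ᵥ y = ∑ k, ∑ i, x (i, k) * ∑ j, 𝒜 i j * (x (i, k) - x (j, k)) := by
    simp only [dotProduct, Fintype.sum_prod_type_right, hyx]
  have hR : y ⬝ᵥ (blkDiag R *ᵥ y) ≤ ∑ k, ∑ i, 1 / (2 * d i) * y (i, k) ^ 2 := by
    rw [dotProduct_blkDiag_mulVec, Finset.sum_comm]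
    refine Finset.sum_le_sum fun i _ => ?_
    have h := (hRub i).posSemidef.dotProduct_mulVec_nonneg fun k => y (i, k)
    rw [star_trivial, dotProduct_smul_one_sub_mulVec] at h
    linarith
  have hRL : ∑ k, ∑ i, 1 / (2 * d i) * y (i, k) ^ 2 ≤ x ⬝ᵥ y := by
    rw [hxy]
    refine Finset.sum_le_sum fun k _ => ?_
    simp only [hyx]
    exact sum_sq_laplacian_div_le 𝒜 h𝒜symm h𝒜nonneg d hd hdpos fun i => x (i, k)
  have hLD : x ⬝ᵥ y ≤ ∑ k, ∑ i, 2 * d i * x (i, k) ^ 2 := by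
    rw [hxy]
    exact Finset.sum_le_sum fun k _ =>
      sum_laplacian_le 𝒜 h𝒜symm h𝒜nonneg d hd fun i => x (i, k)
  have hLnn : 0 ≤ x ⬝ᵥ y := le_trans (Finset.sum_nonneg fun k _ => Finset.sum_nonneg fun i _ =>
    mul_nonneg (by have := hdpos i; positivity) (sq_nonneg _)) hRL
  have hQi : ∀ i, (fun k => x (i, k)) ⬝ᵥ
      ((-((2 * d i * αt) • (1 : Matrix (Fin m) (Fin m) ℝ)) - Q i) *ᵥ fun k => x (i, k))
      = -(αt * ∑ k, 2 * d i * x (i, k) ^ 2)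
        - (fun k => x (i, k)) ⬝ᵥ (Q i *ᵥ fun k => x (i, k)) := fun i => by
    rw [← neg_smul, dotProduct_smul_one_sub_mulVec, Finset.mul_sum, ← Finset.sum_neg_distrib]
    congr 1
    exact Finset.sum_congr rfl fun k _ => by ring
  have hQ : 0 < -(αt * ∑ k, ∑ i, 2 * d i * x (i, k) ^ 2) - x ⬝ᵥ (blkDiag Q *ᵥ x) := by
    rw [dotProduct_blkDiag_mulVec, Finset.sum_comm, Finset.mul_sum, ← Finset.sum_neg_distrib,
      ← Finset.sum_sub_distrib]
    simp only [← hQi]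
    obtain ⟨⟨i, k⟩, hik⟩ := Function.ne_iff.mp hx
    refine Finset.sum_pos' (fun i _ => ?_) ⟨i, Finset.mem_univ i, ?_⟩
    · simpa using (hQub i).posSemidef.dotProduct_mulVec_nonneg fun k => x (i, k)
    · have hne : (fun k => x (i, k)) ≠ 0 := fun h => hik (congrFun h k)
      simpa using (hQub i).dotProduct_mulVec_pos hne
  have hα1 : 1 - α ≤ αt := hαt ▸ le_max_left _ _
  have hα0 : 0 ≤ αt := hαt ▸ le_max_right _ _
  rw [hquad]
  linarith [mul_le_mul_of_nonneg_right hα1 hLnn, mul_le_mul_of_nonneg_left hLD hα0]
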